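/- arXiv:math/0511381 — 3 statements merged into one kernel-verified Lean document; each statement's English description precedes it below -/
import Mathlib

section
/- (Assemblies) Suppose ã_k^{(j)} = a_j^k/k! with a_j > 0 for all j ≥ 1 (the Poisson/assembly case). Then the counting process is convergent (for every l ≥ 1 and (k_1,…,k_l) ∈ ℕ^l the limit of P_n(k_1,…,k_l) exists and for each l these limits sum to 1) if and only if there exists ρ ∈ [0,∞) with (c̃_n)_{n≥0} ∈ RT_ρ. Moreover, in that case, for every l ≥ 1, T̃^{(l)}_n/c̃_n → exp(−∑_{j=1}^l a_j ρ^j) ∈ (0,∞) as n → ∞. -/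
open Finset Filter Topology

/-- The scaled partition function `c̃_n = ∑_{η ∈ Ω_n} ∏_{j=1}^n b_{k_j}^{(j)}` associated
with scaled weights `b j k = ã_k^{(j)}` (so `c̃_0 = 1`). -/
noncomputable def ctilOf (b : ℕ → ℕ → ℝ) (n : ℕ) : ℝ :=
  ∑ P : Nat.Partition n, ∏ j ∈ Finset.Icc 1 n, b j (Multiset.count j P.parts)

/-- The tail sums `T̃^{(l)}_m`: the sum over partitions of `m` with all parts `> l` of
`∏_{j=l+1}^m ã_{k_j}^{(j)}` (so `T̃^{(l)}_0 = 1`). -/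
noncomputable def TtilOf (b : ℕ → ℕ → ℝ) (l m : ℕ) : ℝ :=
  ∑ P : Nat.Partition m,
    if ∀ j ∈ P.parts, l < j
    then ∏ j ∈ Finset.Icc (l + 1) m, b j (Multiset.count j P.parts) else 0

/-- The marginal probability `P_n(k_1,…,k_l) = (∏_{j=1}^l ã_{k_j}^{(j)}) T̃^{(l)}_{n-M_l}/c̃_n`
where `M_l = ∑_{j=1}^l j k_j`. -/
noncomputable def PformOf (b : ℕ → ℕ → ℝ) (l : ℕ) (k : Fin l → ℕ) (n : ℕ) : ℝ :=
  (∏ i : Fin l, b ((i : ℕ) + 1) (k i))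
    * TtilOf b l (n - ∑ i : Fin l, ((i : ℕ) + 1) * k i) / ctilOf b n

/-- A sequence of nonnegative reals is in `RT_ρ` if `d_n/d_{n+1} → ρ`. -/
def RT (d : ℕ → ℝ) (ρ : ℝ) : Prop :=
  Tendsto (fun n => d n / d (n + 1)) atTop (nhds ρ)

/-- The counting process is convergent: all finite-dimensional marginals converge and
the limits form probability laws. -/
def ConvergentOf (b : ℕ → ℕ → ℝ) : Prop :=
  ∃ F : (l : ℕ) → (Fin l → ℕ) → ℝ,
    (∀ l, 1 ≤ l → ∀ k : Fin l → ℕ,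
      Tendsto (fun n => PformOf b l k n) atTop (nhds (F l k))) ∧
    (∀ l, 1 ≤ l → HasSum (F l) 1)

/-- Scaled weights of an assembly: `ã_k^{(j)} = a_j^k/k!` (Poisson case). -/
noncomputable def asmWt (aseq : ℕ → ℝ) (j k : ℕ) : ℝ :=
  aseq j ^ k / (Nat.factorial k : ℝ)

open PowerSeries PowerSeries.WithPiTopology in
/-- The power series `exp (b X ^ l)` as a convergent sum of monomials. -/
theorem hasSum_expand_rescale_exp (l : ℕ) (hl : l ≠ 0) (b : ℝ) :
    HasSum (fun k : ℕ => (b ^ k / (Nat.factorial k : ℝ)) • (X : PowerSeries ℝ) ^ (l * k))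
      (expand l hl (rescale b (exp ℝ))) := by
  rw [hasSum_iff_hasSum_coeff]
  intro d
  by_cases hd : l ∣ d
  · obtain ⟨m, rfl⟩ := hd
    have h := hasSum_single (f := fun k : ℕ => coeff (l * m)
      ((b ^ k / (Nat.factorial k : ℝ)) • (X : PowerSeries ℝ) ^ (l * k))) m (by
        intro k hk
        have : l * m ≠ l * k := fun h => hk (Nat.eq_of_mul_eq_mul_left (by omega) h).symm
        simp [coeff_X_pow, this])
    have hcoeff : coeff (l * m) (expand l hl (rescale b (exp ℝ))) =
        coeff (l * m) ((b ^ m / (Nat.factorial m : ℝ)) • (X : PowerSeries ℝ) ^ (l * m)) := by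
      rw [coeff_expand_mul]
      simp [coeff_X_pow, coeff_exp, div_eq_mul_inv]
    rwa [hcoeff]
  · rw [coeff_expand_of_not_dvd _ _ _ hd]
    refine hasSum_zero.congr_fun fun k => ?_
    have : d ≠ l * k := fun h => hd ⟨k, h⟩
    simp [coeff_X_pow, this]

open PowerSeries PowerSeries.WithPiTopology in
/-- The coefficients of `exp (b X ^ l) * T` as convergent sums. -/
theorem hasSum_coeff_expand_exp_mul (l : ℕ) (hl : l ≠ 0) (b : ℝ) (T : PowerSeries ℝ) (n : ℕ) :
    HasSum (fun k : ℕ => b ^ k / (Nat.factorial k : ℝ) *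
      (if l * k ≤ n then coeff (n - l * k) T else 0))
      (coeff n (expand l hl (rescale b (exp ℝ)) * T)) := by
  have h := (hasSum_expand_rescale_exp l hl b).mul_right T
  rw [hasSum_iff_hasSum_coeff] at h
  simpa [smul_mul_assoc, coeff_X_pow_mul'] using h n

open PowerSeries in
theorem expand_exp_neg_mul_expand_exp (l : ℕ) (hl : l ≠ 0) (b : ℝ) :
    expand l hl (rescale (-b) (exp ℝ)) * expand l hl (rescale b (exp ℝ)) = 1 := by
  rw [← map_mul, exp_mul_exp_eq_exp_add]
  simp

/-- The weights of an assembly restricted to parts larger than `l`. -/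
noncomputable def tailWt (aseq : ℕ → ℝ) (l j k : ℕ) : ℝ :=
  if j ≤ l then 0 else asmWt aseq j k

open PowerSeries PowerSeries.WithPiTopology in
theorem genFun_tailWt_succ (aseq : ℕ → ℝ) (l : ℕ) :
    Nat.Partition.genFun (tailWt aseq l) =
      expand (l + 1) l.succ_ne_zero (rescale (aseq (l + 1)) (exp ℝ)) *
        Nat.Partition.genFun (tailWt aseq (l + 1)) := by
  have hE := hasSum_expand_rescale_exp (l + 1) l.succ_ne_zero (aseq (l + 1))
  set E := expand (l + 1) l.succ_ne_zero (rescale (aseq (l + 1)) (exp ℝ))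
  have h1 : HasProd (Pi.mulSingle l E : ℕ → PowerSeries ℝ) E := by
    simpa using hasProd_single (f := (Pi.mulSingle l E : ℕ → PowerSeries ℝ)) l
      (fun i hi => Pi.mulSingle_eq_of_ne (M := fun _ : ℕ => PowerSeries ℝ) hi E)
  have h2 := h1.mul (Nat.Partition.hasProd_genFun (tailWt aseq (l + 1)))
  refine (Nat.Partition.hasProd_genFun (tailWt aseq l)).unique
    (h2.congr_fun fun i => ?_)
  rcases eq_or_ne i l with rfl | hi
  · have h3 := hE.summable.tsum_eq_zero_add
    rw [hE.tsum_eq] at h3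
    simp [tailWt, asmWt, h3]
  · rw [Pi.mulSingle_eq_of_ne (M := fun _ : ℕ => PowerSeries ℝ) hi, one_mul]
    have : i + 1 ≤ l ↔ i + 1 ≤ l + 1 := by omega
    simp only [tailWt, this]

theorem TtilOf_asmWt_eq_coeff (aseq : ℕ → ℝ) (l m : ℕ) :
    TtilOf (asmWt aseq) l m =
      PowerSeries.coeff m (Nat.Partition.genFun (tailWt aseq l)) := by
  rw [Nat.Partition.coeff_genFun, TtilOf]
  refine Finset.sum_congr rfl fun P _ => ?_
  rw [Finsupp.prod, Multiset.toFinsupp_support]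
  simp only [Multiset.toFinsupp_apply]
  split_ifs with h
  · symm
    refine Finset.prod_subset_one_on_sdiff ?_ ?_ ?_
    · intro j hj
      rw [Multiset.mem_toFinset] at hj
      exact Finset.mem_Icc.2 ⟨h j hj, P.le_of_mem_parts hj⟩
    · intro j hj
      rw [Finset.mem_sdiff, Multiset.mem_toFinset] at hj
      simp [asmWt, Multiset.count_eq_zero_of_notMem hj.2]
    · intro j hj
      rw [Multiset.mem_toFinset] at hj
      simp [tailWt, (h j hj).not_ge]
  · push Not at h
    obtain ⟨j, hj, hjl⟩ := h
    exact (Finset.prod_eq_zero (Multiset.mem_toFinset.2 hj) (by simp [tailWt, hjl])).symm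

theorem TtilOf_zero (b : ℕ → ℕ → ℝ) (n : ℕ) : TtilOf b 0 n = ctilOf b n := by
  refine Finset.sum_congr rfl fun P _ => ?_
  rw [if_pos fun j hj => P.parts_pos hj]

theorem ctilOf_asmWt_pos {aseq : ℕ → ℝ} (ha : ∀ j, 1 ≤ j → 0 < aseq j) (n : ℕ) :
    0 < ctilOf (asmWt aseq) n := by
  refine Finset.sum_pos (fun P _ => Finset.prod_pos fun j hj => ?_) Finset.univ_nonempty
  have := ha j (Finset.mem_Icc.1 hj).1
  unfold asmWt
  positivity

theorem tendsto_div_shift {d t : ℕ → ℝ} {ρ L : ℝ} (hd : ∀ n, 0 < d n)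
    (hρ : Tendsto (fun n => d n / d (n + 1)) atTop (𝓝 ρ))
    (ht : Tendsto (fun n => t n / d n) atTop (𝓝 L)) (m : ℕ) :
    Tendsto (fun n => t (n - m) / d n) atTop (𝓝 (L * ρ ^ m)) := by
  rw [← tendsto_add_atTop_iff_nat m]
  simp only [Nat.add_sub_cancel]
  induction m with
  | zero => simpa using ht
  | succ m ih =>
    have h := ih.mul (hρ.comp (tendsto_add_atTop_nat m))
    rw [pow_succ, ← mul_assoc]
    refine h.congr fun n => ?_
    have := (hd (n + m)).ne'
    simp only [Function.comp]
    rw [← add_assoc]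
    field_simp

theorem exists_div_le_pow {d : ℕ → ℝ} {ρ : ℝ} (hd : ∀ n, 0 < d n)
    (hρ : Tendsto (fun n => d n / d (n + 1)) atTop (𝓝 ρ)) :
    ∃ R : ℝ, 0 ≤ R ∧ ∀ n m, d n / d (n + m) ≤ R ^ m := by
  obtain ⟨R, hR⟩ := hρ.bddAbove_range
  have hR' : ∀ n, d n / d (n + 1) ≤ R := fun n => hR ⟨n, rfl⟩
  have hR0 : 0 ≤ R := (div_pos (hd 0) (hd 1)).le.trans (hR' 0)
  refine ⟨R, hR0, fun n m => ?_⟩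
  induction m with
  | zero => simp [div_self (hd n).ne']
  | succ m ih =>
    have h := mul_le_mul ih (hR' (n + m)) (div_pos (hd _) (hd _)).le (pow_nonneg hR0 m)
    rw [div_mul_div_cancel₀ (hd (n + m)).ne'] at h
    simpa [pow_succ, add_assoc] using h

open PowerSeries in
/-- Multiplication by `exp (b X ^ l)` preserves asymptotic proportionality of the coefficients to
a sequence `d` with `d n / d (n + 1) → ρ`, and scales the constant by `exp (b ρ ^ l)`. -/
theorem tendsto_coeff_expand_exp_mul_div {d : ℕ → ℝ} {ρ L : ℝ} (hd : ∀ n, 0 < d n)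
    (hρ : Tendsto (fun n => d n / d (n + 1)) atTop (𝓝 ρ)) {T : PowerSeries ℝ}
    (hT : Tendsto (fun n => coeff n T / d n) atTop (𝓝 L)) (l : ℕ) (hl : l ≠ 0) (b : ℝ) :
    Tendsto (fun n => coeff n (expand l hl (rescale b (PowerSeries.exp ℝ)) * T) / d n) atTop
      (𝓝 (L * Real.exp (b * ρ ^ l))) := by
  obtain ⟨R, hR0, hR⟩ := exists_div_le_pow hd hρ
  obtain ⟨B, hB⟩ := hT.abs.bddAbove_range
  have hB' : ∀ n, |coeff n T / d n| ≤ B := fun n => hB ⟨n, rfl⟩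
  have hB0 : 0 ≤ B := (abs_nonneg _).trans (hB' 0)
  have hexp (x : ℝ) : HasSum (fun k : ℕ => x ^ k / (Nat.factorial k : ℝ)) (Real.exp x) := by
    rw [Real.exp_eq_exp_ℝ]
    exact NormedSpace.expSeries_div_hasSum_exp x
  have hlim : L * Real.exp (b * ρ ^ l) =
      ∑' k : ℕ, b ^ k / (Nat.factorial k : ℝ) * (L * ρ ^ (l * k)) := by
    rw [← ((hexp (b * ρ ^ l)).mul_left L).tsum_eq]
    refine tsum_congr fun k => ?_
    rw [mul_pow, pow_mul]
    ring
  have hfun (n : ℕ) : coeff n (expand l hl (rescale b (PowerSeries.exp ℝ)) * T) / d n =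
      ∑' k : ℕ, b ^ k / (Nat.factorial k : ℝ) *
        (if l * k ≤ n then coeff (n - l * k) T / d n else 0) := by
    rw [← ((hasSum_coeff_expand_exp_mul l hl b T n).div_const (d n)).tsum_eq]
    refine tsum_congr fun k => ?_
    split_ifs <;> simp [mul_div_assoc]
  rw [hlim]
  simp only [hfun]
  refine tendsto_tsum_of_dominated_convergence
    (bound := fun k => (|b| * R ^ l) ^ k / (Nat.factorial k : ℝ) * B)
    ((hexp _).summable.mul_right B) (fun k => ?_) (Eventually.of_forall fun n k => ?_)
  · refine Tendsto.const_mul _ ((tendsto_div_shift (t := fun n => coeff n T)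
      hd hρ hT (l * k)).congr' ?_)
    filter_upwards [eventually_ge_atTop (l * k)] with n hn
    rw [if_pos hn]
  · split_ifs with h
    · obtain ⟨m, rfl⟩ := Nat.exists_eq_add_of_le' h
      have h1 : coeff m T / d (m + l * k) = coeff m T / d m * (d m / d (m + l * k)) :=
        (div_mul_div_cancel₀ (hd m).ne').symm
      have h2 : |coeff m T / d (m + l * k)| ≤ B * R ^ (l * k) := by
        rw [h1, abs_mul, abs_of_pos (div_pos (hd m) (hd _))]
        exact mul_le_mul (hB' m) (hR m _) (div_pos (hd m) (hd _)).le hB0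
      rw [Nat.add_sub_cancel, Real.norm_eq_abs, abs_mul, abs_div, abs_pow, Nat.abs_cast]
      calc |b| ^ k / (Nat.factorial k : ℝ) * |coeff m T / d (m + l * k)|
          ≤ |b| ^ k / (Nat.factorial k : ℝ) * (B * R ^ (l * k)) := by gcongr
        _ = _ := by rw [mul_pow, pow_mul]; ring
    · simp only [mul_zero, norm_zero]
      positivity

theorem tendsto_TtilOf_div_ctilOf {aseq : ℕ → ℝ} (ha : ∀ j, 1 ≤ j → 0 < aseq j) {ρ : ℝ}
    (hρ : RT (ctilOf (asmWt aseq)) ρ) (l : ℕ) :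
    Tendsto (fun n => TtilOf (asmWt aseq) l n / ctilOf (asmWt aseq) n) atTop
      (𝓝 (Real.exp (-∑ j ∈ Finset.Icc 1 l, aseq j * ρ ^ j))) := by
  have hc := ctilOf_asmWt_pos ha
  induction l with
  | zero => simp [TtilOf_zero, div_self (hc _).ne']
  | succ l ih =>
    simp only [TtilOf_asmWt_eq_coeff] at ih ⊢
    have h := tendsto_coeff_expand_exp_mul_div hc hρ ih (l + 1) l.succ_ne_zero (-aseq (l + 1))
    rw [genFun_tailWt_succ, ← mul_assoc, expand_exp_neg_mul_expand_exp, one_mul,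
      ← Real.exp_add] at h
    rw [Finset.sum_Icc_succ_top (by omega), neg_add, ← neg_mul]
    exact h

theorem hasSum_prod_fin_pi {l : ℕ} {f : Fin l → ℕ → ℝ} {s : Fin l → ℝ}
    (hf : ∀ i k, 0 ≤ f i k) (hs : ∀ i, HasSum (f i) (s i)) :
    HasSum (fun k : Fin l → ℕ => ∏ i, f i (k i)) (∏ i, s i) := by
  induction l with
  | zero => simp
  | succ l ih =>
    have h0 := hs 0
    have h1 := ih (f := fun i => f i.succ) (fun i k => hf _ k) (fun i => hs i.succ)
    have hf0 : 0 ≤ f 0 := hf 0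
    have hf1 : 0 ≤ fun k : Fin l → ℕ => ∏ i : Fin l, f i.succ (k i) :=
      fun k => Finset.prod_nonneg fun i _ => hf i.succ (k i)
    have hsummable := h0.summable.mul_of_nonneg h1.summable hf0 hf1
    have h2 := h0.mul h1 hsummable
    rw [Fin.prod_univ_succ, ← (Fin.consEquiv fun _ => ℕ).hasSum_iff]
    refine h2.congr_fun fun p => ?_
    simp [Fin.prod_univ_succ, Fin.consEquiv]

/-- An assembly whose scaled partition function is in `RT_ρ` is convergent, with independent
Poisson limits of parameters `a_j ρ ^ j`. -/
theorem convergentOf_of_RT {aseq : ℕ → ℝ} (ha : ∀ j, 1 ≤ j → 0 < aseq j) {ρ : ℝ} (hρ0 : 0 ≤ ρ)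
    (hρ : RT (ctilOf (asmWt aseq)) ρ) : ConvergentOf (asmWt aseq) := by
  refine ⟨fun l k => ∏ i : Fin l, (asmWt (fun j => aseq j * ρ ^ j) ((i : ℕ) + 1) (k i) *
    Real.exp (-(aseq ((i : ℕ) + 1) * ρ ^ ((i : ℕ) + 1)))), fun l _ k => ?_, fun l _ => ?_⟩
  · have h := (tendsto_div_shift (ctilOf_asmWt_pos ha) hρ (tendsto_TtilOf_div_ctilOf ha hρ l)
      (∑ i : Fin l, ((i : ℕ) + 1) * k i)).const_mul
        (∏ i : Fin l, asmWt aseq ((i : ℕ) + 1) (k i))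
    simp only [PformOf, mul_div_assoc]
    convert h using 2
    have hsum : ∑ j ∈ Finset.Icc 1 l, aseq j * ρ ^ j =
        ∑ i : Fin l, aseq ((i : ℕ) + 1) * ρ ^ ((i : ℕ) + 1) := by
      rw [Fin.sum_univ_eq_sum_range (fun i => aseq (i + 1) * ρ ^ (i + 1)),
        Finset.range_eq_Ico, Finset.sum_Ico_add' (fun j => aseq j * ρ ^ j)]
      rfl
    rw [hsum, ← Finset.sum_neg_distrib, Real.exp_sum, ← Finset.prod_pow_eq_pow_sum,
      ← Finset.prod_mul_distrib, ← Finset.prod_mul_distrib]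
    refine Finset.prod_congr rfl fun i _ => ?_
    simp only [asmWt, mul_pow, ← pow_mul]
    ring
  · have hpos (i : Fin l) : 0 ≤ aseq ((i : ℕ) + 1) * ρ ^ ((i : ℕ) + 1) :=
      mul_nonneg (ha _ (by omega)).le (pow_nonneg hρ0 _)
    have hone : ∏ _i : Fin l, (1 : ℝ) = 1 := Finset.prod_const_one
    rw [← hone]
    refine hasSum_prod_fin_pi (s := fun _ => 1) (f := fun (i : Fin l) k =>
      asmWt (fun j => aseq j * ρ ^ j) ((i : ℕ) + 1) k *
        Real.exp (-(aseq ((i : ℕ) + 1) * ρ ^ ((i : ℕ) + 1)))) (fun i k => ?_) fun i => ?_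
    · have := hpos i
      unfold asmWt
      positivity
    · have h := (NormedSpace.expSeries_div_hasSum_exp
        (aseq ((i : ℕ) + 1) * ρ ^ ((i : ℕ) + 1))).mul_right
        (Real.exp (-(aseq ((i : ℕ) + 1) * ρ ^ ((i : ℕ) + 1))))
      rwa [← Real.exp_eq_exp_ℝ, ← Real.exp_add, add_neg_cancel, Real.exp_zero] at h

/-- If the counting process of an assembly converges, then its scaled partition function
is in `RT_ρ` for some finite `ρ`. -/
theorem exists_RT_of_convergentOf {aseq : ℕ → ℝ} (ha : ∀ j, 1 ≤ j → 0 < aseq j)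
    (h : ConvergentOf (asmWt aseq)) : ∃ ρ : ℝ, 0 ≤ ρ ∧ RT (ctilOf (asmWt aseq)) ρ := by
  obtain ⟨F, hF, hsum⟩ := h
  have hc := ctilOf_asmWt_pos ha
  have hw (k : ℕ) : 0 < asmWt aseq 1 k := by
    have := ha 1 le_rfl
    unfold asmWt
    positivity
  have hlim (m : ℕ) : Tendsto (fun n => TtilOf (asmWt aseq) 1 n / ctilOf (asmWt aseq) (n + m))
      atTop (𝓝 (F 1 (fun _ => m) / asmWt aseq 1 m)) := by
    have h1 := ((hF 1 le_rfl fun _ => m).div_const (asmWt aseq 1 m)).comp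
      (tendsto_add_atTop_nat m)
    refine h1.congr fun n => ?_
    have := (hw m).ne'
    simp [PformOf]
    field_simp
  obtain ⟨k, hk⟩ : ∃ k, F 1 k ≠ 0 := by
    by_contra! h0
    have h1 := hsum 1 le_rfl
    rw [show F 1 = fun _ => 0 from funext h0] at h1
    exact one_ne_zero (h1.unique hasSum_zero)
  have hkm : k = fun _ => k 0 := by
    ext i
    rw [Subsingleton.elim i 0]
  generalize k 0 = m at hkm
  subst hkm
  have hne : F 1 (fun _ => m) / asmWt aseq 1 m ≠ 0 := div_ne_zero hk (hw m).ne'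
  have hratio := (hlim (m + 1)).div (hlim m) hne
  have hRT : RT (ctilOf (asmWt aseq))
      (F 1 (fun _ => m + 1) / asmWt aseq 1 (m + 1) / (F 1 (fun _ => m) / asmWt aseq 1 m)) := by
    rw [RT, ← tendsto_add_atTop_iff_nat m]
    refine hratio.congr' ?_
    filter_upwards [(hlim m).eventually_ne hne] with n hn
    have hT : TtilOf (asmWt aseq) 1 n ≠ 0 := fun h0 => hn (by simp [h0])
    have h1 := (hc (n + m)).ne'
    have h2 := (hc (n + m + 1)).ne'
    simp only [Pi.div_apply, ← add_assoc]
    field_simp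
  exact ⟨_, ge_of_tendsto' hRT fun n => (div_pos (hc _) (hc _)).le, hRT⟩

/-- **Assemblies.** For `ã_k^{(j)} = a_j^k/k!` with `a_j > 0`: the counting process is
convergent if and only if `(c̃_n) ∈ RT_ρ` for some `ρ ∈ [0,∞)`; moreover, in that case,
for every `l ≥ 1`, `T̃^{(l)}_n/c̃_n → exp(−∑_{j=1}^l a_j ρ^j) ∈ (0,∞)`. -/
theorem stmt11 (aseq : ℕ → ℝ) (ha : ∀ j, 1 ≤ j → 0 < aseq j) :
    (ConvergentOf (asmWt aseq) ↔ ∃ ρ : ℝ, 0 ≤ ρ ∧ RT (ctilOf (asmWt aseq)) ρ) ∧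
    ∀ ρ : ℝ, 0 ≤ ρ → RT (ctilOf (asmWt aseq)) ρ →
      ∀ l, 1 ≤ l →
        Tendsto (fun n => TtilOf (asmWt aseq) l n / ctilOf (asmWt aseq) n) atTop
          (nhds (Real.exp (-∑ j ∈ Finset.Icc 1 l, aseq j * ρ ^ j))) := by
  exact ⟨⟨exists_RT_of_convergentOf ha, fun ⟨_, hρ0, hρ⟩ => convergentOf_of_RT ha hρ0 hρ⟩,
    fun _ _ hρ l _ => tendsto_TtilOf_div_ctilOf ha hρ l⟩
end

section
/- (Multisets with smoothly growing weights diverge) Suppose ã_k^{(j)} = C(m_j+k−1, k)·p^{jk}, where the m_j are positive integers with m_j/m_{j+1} → 1 as j → ∞, and 0 < p < 1. Then for every l ≥ 1 and every tuple (k_1,…,k_l) ∈ ℕ^l, lim_{n→∞} P_n(k_1,…,k_l) = 0; in particular the finite-dimensional laws of the component counts converge weakly to no probability law, i.e., the multiset is divergent. -/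
open Finset Filter Topology

/-- Scaled weights of a multiset: `ã_k^{(j)} = C(m_j+k−1, k) p^{jk}`
(negative-binomial case). -/
noncomputable def msWt (m : ℕ → ℕ) (p : ℝ) (j k : ℕ) : ℝ :=
  (Nat.choose (m j + k - 1) k : ℝ) * p ^ (j * k)

/-- The number of multisets whose component sizes are the elements of `s`, when there are `m j`
available components of size `j`. -/
def multisetWeight (m : ℕ → ℕ) (s : Multiset ℕ) : ℕ :=
  ∏ j ∈ s.toFinset, (m j).multichoose (s.count j)

/-- The number of multisets of total size `n`, when there are `m j` components of size `j`. -/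
def multisetCount (m : ℕ → ℕ) (n : ℕ) : ℕ :=
  ∑ P : Nat.Partition n, multisetWeight m P.parts

/-- `multisetCount m (n - s)`, with value zero when `n < s`. -/
def shiftedCount (m : ℕ → ℕ) (n s : ℕ) : ℕ :=
  if s ≤ n then multisetCount m (n - s) else 0

theorem multisetWeight_eq_prod (m : ℕ → ℕ) {s : Multiset ℕ} {S : Finset ℕ}
    (h : s.toFinset ⊆ S) :
    multisetWeight m s = ∏ j ∈ S, (m j).multichoose (s.count j) := by
  refine Finset.prod_subset h fun j _ hj => ?_
  rw [Multiset.count_eq_zero_of_notMem (by simpa using hj), Nat.multichoose_zero_right]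

theorem multichoose_pos_of_pos {a : ℕ} (ha : 1 ≤ a) (k : ℕ) : 1 ≤ a.multichoose k := by
  rw [Nat.multichoose_eq]
  exact Nat.choose_pos (by omega)

theorem succ_mul_multichoose_succ (a k : ℕ) :
    (k + 1) * a.multichoose (k + 1) = (a + k) * a.multichoose k := by
  rcases a with _ | a
  · cases k <;> simp
  · rw [Nat.multichoose_eq, Nat.multichoose_eq]
    have h := Nat.add_one_mul_choose_eq (a + k) k
    have e1 : a + 1 + (k + 1) - 1 = (a + k).succ := by omega
    have e2 : a + 1 + k - 1 = a + k := by omega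
    rw [e1, e2]
    simp only [Nat.succ_eq_add_one] at h ⊢
    linarith

theorem mul_multichoose_eq_sum (a k : ℕ) :
    k * a.multichoose k = a * ∑ i ∈ Icc 1 k, a.multichoose (k - i) := by
  have h : ∑ i ∈ Icc 1 k, a.multichoose (k - i) = ∑ i ∈ range k, a.multichoose i := by
    refine Finset.sum_nbij' (fun i => k - i) (fun i => k - i) ?_ ?_ ?_ ?_ ?_ <;>
      simp only [Finset.mem_Icc, Finset.mem_range] <;> intros <;> first | trivial | omega
  rw [h]
  clear h
  induction k with
  | zero => simp
  | succ k ih => rw [Finset.sum_range_succ, mul_add, ← ih, succ_mul_multichoose_succ]; ring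

theorem multisetWeight_sub_replicate (m : ℕ → ℕ) (s : Multiset ℕ) (j : ℕ) {S : Finset ℕ}
    (h : s.toFinset ⊆ S) (hj : j ∈ S) (i : ℕ) :
    multisetWeight m (s - Multiset.replicate i j) =
      (m j).multichoose (s.count j - i) * ∏ x ∈ S.erase j, (m x).multichoose (s.count x) := by
  have h' : (s - Multiset.replicate i j).toFinset ⊆ S := fun x hx =>
    h (by simpa using Multiset.mem_of_le (Multiset.sub_le_self _ _) (by simpa using hx))
  rw [multisetWeight_eq_prod m h', ← Finset.mul_prod_erase S _ hj]
  congr 1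
  · rw [Multiset.count_sub, Multiset.count_replicate_self]
  · refine Finset.prod_congr rfl fun x hx => ?_
    rw [Multiset.count_sub, Multiset.count_replicate, if_neg (Finset.ne_of_mem_erase hx).symm,
      Nat.sub_zero]

theorem count_mul_multisetWeight (m : ℕ → ℕ) (s : Multiset ℕ) (j : ℕ) :
    s.count j * multisetWeight m s =
      m j * ∑ i ∈ Icc 1 (s.count j), multisetWeight m (s - Multiset.replicate i j) := by
  have h : s.toFinset ⊆ insert j s.toFinset := Finset.subset_insert _ _
  have hj : j ∈ insert j s.toFinset := Finset.mem_insert_self _ _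
  simp_rw [multisetWeight_sub_replicate m s j h hj, ← Finset.sum_mul]
  rw [← mul_assoc, ← mul_multichoose_eq_sum, mul_assoc]
  congr 1
  simpa using multisetWeight_sub_replicate m s j h hj 0

theorem sum_partition_sub_replicate (F : Multiset ℕ → ℕ) {j : ℕ} (hj : 1 ≤ j) {n i : ℕ}
    (h : i * j ≤ n) :
    ∑ P : Nat.Partition n with i ≤ P.parts.count j, F (P.parts - Multiset.replicate i j) =
      ∑ Q : Nat.Partition (n - i * j), F Q.parts := by
  refine Finset.sum_bij'
    (fun P hP => ⟨P.parts - Multiset.replicate i j,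
      fun hx => P.parts_pos (Multiset.mem_of_le (Multiset.sub_le_self _ _) hx), ?_⟩)
    (fun Q _ => ⟨Q.parts + Multiset.replicate i j, ?_, ?_⟩) ?_ ?_ ?_ ?_ ?_
  · have h1 := Multiset.le_count_iff_replicate_le.1 (Finset.mem_filter.1 hP).2
    have h2 := congrArg Multiset.sum (Multiset.sub_add_cancel h1)
    rw [Multiset.sum_add, P.parts_sum, Multiset.sum_replicate, smul_eq_mul] at h2
    omega
  · intro x hx
    rcases Multiset.mem_add.1 hx with hx | hx
    · exact Q.parts_pos hx
    · rw [Multiset.eq_of_mem_replicate hx]; exact hj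
  · rw [Multiset.sum_add, Q.parts_sum, Multiset.sum_replicate, smul_eq_mul]
    omega
  · intro P hP
    exact Finset.mem_univ _
  · intro Q _
    simp
  · intro P hP
    ext1
    exact Multiset.sub_add_cancel
      (Multiset.le_count_iff_replicate_le.1 (Finset.mem_filter.1 hP).2)
  · intro Q _
    ext1
    simp
  · intro P hP
    rfl

theorem count_mul_le {n : ℕ} (P : Nat.Partition n) (j : ℕ) : P.parts.count j * j ≤ n := by
  have h := Multiset.le_count_iff_replicate_le.1 (le_refl (P.parts.count j))
  obtain ⟨u, hu⟩ := Multiset.le_iff_exists_add.1 h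
  have h2 := congrArg Multiset.sum hu
  rw [Multiset.sum_add, P.parts_sum, Multiset.sum_replicate, smul_eq_mul] at h2
  omega

theorem sum_partition_eq_shiftedCount (m : ℕ → ℕ) {j : ℕ} (hj : 1 ≤ j) (n i : ℕ) :
    ∑ P : Nat.Partition n with i ≤ P.parts.count j,
      multisetWeight m (P.parts - Multiset.replicate i j) = shiftedCount m n (i * j) := by
  unfold shiftedCount
  split_ifs with h
  · exact sum_partition_sub_replicate _ hj h
  · refine Finset.sum_eq_zero fun P hP => ?_
    have h1 := (Finset.mem_filter.1 hP).2
    exact absurd ((Nat.mul_le_mul_right j h1).trans (count_mul_le P j)) h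

theorem parts_toFinset_subset {n : ℕ} (P : Nat.Partition n) {N : ℕ} (h : n ≤ N) :
    P.parts.toFinset ⊆ Icc 1 N := fun x hx => by
  have hx := Multiset.mem_toFinset.1 hx
  exact Finset.mem_Icc.2 ⟨P.parts_pos hx, (P.parts_sum ▸ Multiset.le_sum_of_mem hx).trans h⟩

theorem mul_multisetCount (m : ℕ → ℕ) {n N : ℕ} (hN : n ≤ N) :
    n * multisetCount m n =
      ∑ j ∈ Icc 1 N, ∑ i ∈ Icc 1 N, j * m j * shiftedCount m n (i * j) := by
  have key : ∀ P : Nat.Partition n, n * multisetWeight m P.parts =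
      ∑ j ∈ Icc 1 N, ∑ i ∈ Icc 1 N, if i ≤ P.parts.count j then
        j * m j * multisetWeight m (P.parts - Multiset.replicate i j) else 0 := by
    intro P
    have h1 : n = ∑ j ∈ Icc 1 N, P.parts.count j * j := by
      conv_lhs => rw [← P.parts_sum, Finset.sum_multiset_count]
      simp_rw [smul_eq_mul]
      refine Finset.sum_subset (parts_toFinset_subset P hN) fun j _ hj => ?_
      rw [Multiset.count_eq_zero_of_notMem (by simpa using hj), zero_mul]
    refine (congrArg (· * multisetWeight m P.parts) h1).trans ?_
    simp only [Finset.sum_mul]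
    refine Finset.sum_congr rfl fun j hj => ?_
    have h2 : (Icc 1 N).filter (fun i => i ≤ P.parts.count j) = Icc 1 (P.parts.count j) := by
      have h3 : P.parts.count j ≤ N :=
        ((Nat.le_mul_of_pos_right _ (Finset.mem_Icc.1 hj).1).trans (count_mul_le P j)).trans hN
      ext i
      simp only [Finset.mem_filter, Finset.mem_Icc]
      omega
    rw [← Finset.sum_filter, h2, ← Finset.mul_sum, mul_assoc, mul_left_comm, mul_assoc,
      ← count_mul_multisetWeight]
  unfold multisetCount
  rw [Finset.mul_sum, Finset.sum_congr rfl fun P _ => key P, Finset.sum_comm]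
  refine Finset.sum_congr rfl fun j hj => ?_
  rw [Finset.sum_comm]
  refine Finset.sum_congr rfl fun i _ => ?_
  rw [← Finset.sum_filter, ← Finset.mul_sum,
    sum_partition_eq_shiftedCount m (Finset.mem_Icc.1 hj).1]

theorem multisetWeight_sub_replicate_le (m : ℕ → ℕ) {j : ℕ} (hj : 1 ≤ m j) (s : Multiset ℕ)
    (i : ℕ) (hi : i ≤ s.count j) :
    multisetWeight m (s - Multiset.replicate i j) ≤ multisetWeight m s := by
  have h : s.toFinset ⊆ insert j s.toFinset := Finset.subset_insert _ _
  have hj' : j ∈ insert j s.toFinset := Finset.mem_insert_self _ _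
  rw [multisetWeight_sub_replicate m s j h hj', multisetWeight_eq_prod m h,
    ← Finset.mul_prod_erase _ _ hj']
  refine Nat.mul_le_mul_right _ ?_
  rw [Nat.multichoose_eq, Nat.multichoose_eq, ← Nat.choose_symm (by omega),
    ← Nat.choose_symm (n := m j + s.count j - 1) (by omega)]
  have e1 : m j + (s.count j - i) - 1 - (s.count j - i) = m j - 1 := by omega
  have e2 : m j + s.count j - 1 - s.count j = m j - 1 := by omega
  rw [e1, e2]
  exact Nat.choose_le_choose _ (by omega)

theorem multisetCount_sub_le (m : ℕ → ℕ) {j n : ℕ} (hj : 1 ≤ j) (hm : 1 ≤ m j) (h : j ≤ n) :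
    multisetCount m (n - j) ≤ multisetCount m n := by
  have e := sum_partition_sub_replicate (multisetWeight m) hj (n := n) (i := 1) (by omega)
  rw [one_mul] at e
  unfold multisetCount
  rw [← e]
  refine (Finset.sum_le_sum fun P hP => ?_).trans
    (Finset.sum_le_sum_of_subset (Finset.filter_subset _ _))
  exact multisetWeight_sub_replicate_le m hm _ _ (Finset.mem_filter.1 hP).2

theorem multisetWeight_eq_zero {m : ℕ → ℕ} {j : ℕ} (hj : m j = 0) {s : Multiset ℕ}
    (h : j ∈ s) : multisetWeight m s = 0 := by
  refine Finset.prod_eq_zero (Multiset.mem_toFinset.2 h) ?_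
  obtain ⟨k, hk⟩ := Nat.exists_eq_succ_of_ne_zero (Multiset.count_ne_zero.2 h)
  rw [hj, hk, Nat.multichoose_zero_succ]

theorem sum_multisetCount_le {m m' : ℕ → ℕ} (hm : ∀ j, 1 ≤ m j) (hm' : ∀ j, m' j = 0 ∨ m' j = m j)
    (h1 : m' 1 = 0) (n : ℕ) :
    ∑ i ∈ range (n + 1), multisetCount m' i ≤ multisetCount m n := by
  have hs : ∀ k ∈ range (n + 1), multisetCount m' (n + 1 - 1 - k) =
      ∑ P : Nat.Partition n, if P.parts.count 1 = k then
        multisetWeight m' (P.parts - Multiset.replicate k 1) else 0 := by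
    intro k hk
    have hk' : k * 1 ≤ n := by have := Finset.mem_range.1 hk; omega
    have e := sum_partition_sub_replicate (multisetWeight m') (le_refl 1) hk'
    rw [mul_one] at e
    rw [Nat.add_sub_cancel, multisetCount, ← e, Finset.sum_filter]
    refine Finset.sum_congr rfl fun P _ => ?_
    rcases lt_trichotomy k (P.parts.count 1) with h | h | h
    · rw [if_pos h.le, if_neg h.ne', multisetWeight_eq_zero h1]
      rw [← Multiset.count_pos, Multiset.count_sub, Multiset.count_replicate_self]
      omega
    · rw [if_pos h.le, if_pos h.symm]
    · rw [if_neg (by omega), if_neg (by omega)]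
  rw [← Finset.sum_range_reflect, Finset.sum_congr rfl hs, Finset.sum_comm]
  refine Finset.sum_le_sum fun P _ => ?_
  rw [Finset.sum_ite_eq]
  split_ifs
  · refine le_trans ?_ (multisetWeight_sub_replicate_le m (hm 1) _ _ le_rfl)
    refine Finset.prod_le_prod' fun j _ => ?_
    rcases hm' j with h | h
    · rw [h]
      rcases Multiset.count j (P.parts - Multiset.replicate (P.parts.count 1) 1) with _ | k <;> simp
    · rw [h]
  · exact Nat.zero_le _

theorem sum_shiftedCount_le (m : ℕ → ℕ) {j : ℕ} (hj : 1 ≤ j) (n N : ℕ) :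
    ∑ i ∈ Icc 1 N, shiftedCount m n (i * j) ≤ ∑ i ∈ range (n + 1), multisetCount m i := by
  unfold shiftedCount
  rw [← Finset.sum_filter]
  have hinj : Set.InjOn (fun i => n - i * j) ((Icc 1 N).filter fun i => i * j ≤ n) := by
    intro a ha b hb hab
    simp only [Finset.coe_filter, Set.mem_ofPred_eq] at ha hb hab
    exact Nat.eq_of_mul_eq_mul_right hj (by omega)
  rw [← Finset.sum_image (f := multisetCount m) hinj]
  refine Finset.sum_le_sum_of_subset fun x hx => ?_
  obtain ⟨i, _, rfl⟩ := Finset.mem_image.1 hx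
  simp only [Finset.mem_range]
  omega

theorem mul_multisetCount_le {m : ℕ → ℕ} {l r J : ℕ} (hm : ∀ j, l < j → 1 ≤ m j)
    (hJ : l + r + 1 ≤ J) (hmul : ∀ j, J ≤ j + r → (j + r) * m (j + r) ≤ 2 * (j * m j)) {n : ℕ}
    (hn : r ≤ n) :
    n * multisetCount m n ≤ 3 * ((n - r) * multisetCount m (n - r)) +
      (∑ j ∈ range J, j * m j) * ∑ i ∈ range (n + 1), multisetCount m i := by
  have hsmall : ∑ j ∈ (Icc 1 n).filter (fun j => ¬ J ≤ j), ∑ i ∈ Icc 1 n,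
      j * m j * shiftedCount m n (i * j) ≤
      (∑ j ∈ range J, j * m j) * ∑ i ∈ range (n + 1), multisetCount m i := by
    rw [Finset.sum_mul]
    refine (Finset.sum_le_sum fun j hj => ?_).trans
      (Finset.sum_le_sum_of_subset (s := (Icc 1 n).filter (fun j => ¬ J ≤ j)) fun j hj => ?_)
    · rw [← Finset.mul_sum]
      refine Nat.mul_le_mul_left _ (sum_shiftedCount_le m ?_ _ _)
      exact (Finset.mem_Icc.1 (Finset.mem_filter.1 hj).1).1
    · have := (Finset.mem_filter.1 hj).2
      exact Finset.mem_range.2 (by omega)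
  have hrec := mul_multisetCount m (Nat.sub_le n r)
  have hfirst : ∑ j ∈ (Icc 1 n).filter (fun j => J ≤ j), j * m j * shiftedCount m n j ≤
      2 * ((n - r) * multisetCount m (n - r)) := by
    have hle : ∑ j ∈ Icc 1 n, j * m j * shiftedCount m (n - r) j ≤
        (n - r) * multisetCount m (n - r) := by
      rw [hrec]
      refine Finset.sum_le_sum fun j hj => ?_
      have h1 : 1 ∈ Icc 1 n := by
        have := Finset.mem_Icc.1 hj
        exact Finset.mem_Icc.2 (by omega)
      have h2 := Finset.single_le_sum
        (f := fun i => j * m j * shiftedCount m (n - r) (i * j)) (fun _ _ => Nat.zero_le _) h1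
      simpa using h2
    refine le_trans ?_ (Nat.mul_le_mul_left 2 hle)
    have hinj : Set.InjOn (fun j => j - r) ((Icc 1 n).filter fun j => J ≤ j) := by
      intro a ha b hb hab
      simp only [Finset.coe_filter, Set.mem_ofPred_eq] at ha hb hab
      omega
    have hsub : ((Icc 1 n).filter fun j => J ≤ j).image (fun j => j - r) ⊆ Icc 1 n := by
      intro x hx
      obtain ⟨j, hj, rfl⟩ := Finset.mem_image.1 hx
      simp only [Finset.mem_filter, Finset.mem_Icc] at hj ⊢
      omega
    refine le_trans ?_ (Nat.mul_le_mul_left 2 (Finset.sum_le_sum_of_subset hsub))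
    rw [Finset.sum_image hinj, Finset.mul_sum]
    refine Finset.sum_le_sum fun j hj => ?_
    simp only [Finset.mem_filter, Finset.mem_Icc] at hj
    have h1 := hmul (j - r) (by omega)
    rw [Nat.sub_add_cancel (by omega)] at h1
    have h2 : shiftedCount m n j = shiftedCount m (n - r) (j - r) := by
      unfold shiftedCount
      rw [if_pos (by omega), if_pos (by omega)]
      congr 1
      omega
    rw [h2, ← mul_assoc]
    exact Nat.mul_le_mul_right _ h1
  have hrest : ∑ j ∈ (Icc 1 n).filter (fun j => J ≤ j), ∑ i ∈ Icc 2 n,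
      j * m j * shiftedCount m n (i * j) ≤ (n - r) * multisetCount m (n - r) := by
    rw [hrec]
    refine (Finset.sum_le_sum fun j hj => ?_).trans
      (Finset.sum_le_sum_of_subset (Finset.filter_subset (fun j => J ≤ j) _))
    simp only [Finset.mem_filter, Finset.mem_Icc] at hj
    have hinj : Set.InjOn (fun i => i - 1) (Icc 2 n : Finset ℕ) := by
      intro a ha b hb hab
      simp only [Finset.coe_Icc, Set.mem_Icc] at ha hb hab
      omega
    have hsub : (Icc 2 n).image (fun i => i - 1) ⊆ Icc 1 n := by
      intro x hx
      obtain ⟨i, hi, rfl⟩ := Finset.mem_image.1 hx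
      simp only [Finset.mem_Icc] at hi ⊢
      omega
    refine le_trans ?_ (Finset.sum_le_sum_of_subset hsub)
    rw [Finset.sum_image hinj]
    refine Finset.sum_le_sum fun i hi => Nat.mul_le_mul_left _ ?_
    obtain ⟨i, rfl⟩ : ∃ i', i = i' + 1 := ⟨i - 1, by have := Finset.mem_Icc.1 hi; omega⟩
    rw [Nat.add_sub_cancel]
    unfold shiftedCount
    have h3 : (i + 1) * j = i * j + j := by ring
    rw [h3]
    split_ifs with ha hb
    · have h4 := multisetCount_sub_le m (j := j - r) (n := n - r - i * j) (by omega)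
        (hm _ (by omega)) (by omega)
      convert h4 using 2
      omega
    · omega
    · exact Nat.zero_le _
    · exact Nat.zero_le _
  have hsplit : ∑ j ∈ (Icc 1 n).filter (fun j => J ≤ j), ∑ i ∈ Icc 1 n,
      j * m j * shiftedCount m n (i * j) =
      ∑ j ∈ (Icc 1 n).filter (fun j => J ≤ j), j * m j * shiftedCount m n j +
      ∑ j ∈ (Icc 1 n).filter (fun j => J ≤ j), ∑ i ∈ Icc 2 n,
        j * m j * shiftedCount m n (i * j) := by
    rw [← Finset.sum_add_distrib]
    refine Finset.sum_congr rfl fun j hj => ?_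
    simp only [Finset.mem_filter, Finset.mem_Icc] at hj
    have h5 := Finset.add_sum_Ioc_eq_sum_Icc (f := fun i => j * m j * shiftedCount m n (i * j))
      (show 1 ≤ n by omega)
    rw [← h5, one_mul]
    rfl
  rw [mul_multisetCount m le_rfl, ← Finset.sum_filter_add_sum_filter_not _ (fun j => J ≤ j),
    hsplit]
  omega

theorem eventually_mul_multisetCount_le {m : ℕ → ℕ} {l : ℕ} (hm : ∀ j, l < j → 1 ≤ m j)
    (hmul : ∀ r, ∀ᶠ j in atTop, (j + r) * m (j + r) ≤ 2 * (j * m j)) (K : ℕ) :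
    ∀ᶠ n in atTop, K * multisetCount m n ≤ ∑ i ∈ range (n + 1), multisetCount m i := by
  have hr : ∀ r, ∀ᶠ n in atTop,
      ∑ i ∈ range (n + 1), multisetCount m i < K * multisetCount m n →
        multisetCount m n ≤ 4 * multisetCount m (n - r) := by
    intro r
    obtain ⟨J₀, hJ₀⟩ := eventually_atTop.1 (hmul r)
    obtain ⟨J, hJ, hJ'⟩ : ∃ J, l + r + 1 ≤ J ∧ J₀ + r ≤ J := ⟨J₀ + l + r + 1, by omega, by omega⟩
    obtain ⟨B, hB⟩ : ∃ B, ∑ j ∈ range J, j * m j = B := ⟨_, rfl⟩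
    filter_upwards [eventually_ge_atTop (4 * (B * K) + r + 1)] with n hn hlt
    have h := mul_multisetCount_le hm hJ (fun j hj => hJ₀ j (by omega)) (n := n) (by omega)
    rw [hB] at h
    have h1 : B * ∑ i ∈ range (n + 1), multisetCount m i ≤ B * (K * multisetCount m n) :=
      Nat.mul_le_mul_left _ hlt.le
    have h2 : 4 * (B * K) * multisetCount m n ≤ n * multisetCount m n :=
      Nat.mul_le_mul_right _ (by omega)
    have h3 : (n - r) * multisetCount m (n - r) ≤ n * multisetCount m (n - r) :=
      Nat.mul_le_mul_right _ (Nat.sub_le _ _)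
    refine Nat.le_of_mul_le_mul_left (?_ : n * _ ≤ n * _) (by omega)
    linarith
  have hall : ∀ᶠ n in atTop, ∀ r ∈ range (4 * K),
      ∑ i ∈ range (n + 1), multisetCount m i < K * multisetCount m n →
        multisetCount m n ≤ 4 * multisetCount m (n - r) :=
    (Filter.eventually_all_finset _).2 fun r _ => hr r
  filter_upwards [hall, eventually_ge_atTop (4 * K)] with n hn hK
  by_contra! hlt
  have h1 : ∑ r ∈ range (4 * K), multisetCount m n ≤
      ∑ r ∈ range (4 * K), 4 * multisetCount m (n - r) :=
    Finset.sum_le_sum fun r hr => hn r hr hlt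
  rw [Finset.sum_const, Finset.card_range, smul_eq_mul, ← Finset.mul_sum] at h1
  have h2 : ∑ r ∈ range (4 * K), multisetCount m (n - r) ≤
      ∑ i ∈ range (n + 1), multisetCount m i := by
    rw [← Finset.sum_range_reflect (multisetCount m) (n + 1)]
    refine Finset.sum_le_sum_of_subset (f := fun r => multisetCount m (n - r)) fun r hr => ?_
    have := Finset.mem_range.1 hr
    exact Finset.mem_range.2 (by omega)
  nlinarith

theorem eventually_add_mul_le {m : ℕ → ℕ} (hm : ∀ j, 1 ≤ m j)
    (hsm : Tendsto (fun j => (m j : ℝ) / (m (j + 1) : ℝ)) atTop (nhds 1)) (r : ℕ) :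
    ∀ᶠ j in atTop, (j + r) * m (j + r) ≤ 2 * (j * m j) := by
  have hm0 : ∀ j, (m j : ℝ) ≠ 0 := fun j => by have := hm j; positivity
  have h1 : Tendsto (fun j => (m j : ℝ) / (m (j + r) : ℝ)) atTop (nhds 1) := by
    induction r with
    | zero => simp [div_self (hm0 _)]
    | succ r ih =>
      have h := ih.mul (hsm.comp (tendsto_add_atTop_nat r))
      rw [one_mul] at h
      refine h.congr fun j => ?_
      simp only [Function.comp_apply, ← add_assoc]
      field_simp [hm0]
  have h2 : Tendsto (fun j : ℕ => (j : ℝ) / (j + r)) atTop (nhds 1) :=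
    tendsto_natCast_div_add_atTop (r : ℝ)
  have h3 := h1.mul h2
  rw [one_mul] at h3
  filter_upwards [h3.eventually_const_lt (show (1 / 2 : ℝ) < 1 by norm_num),
    eventually_gt_atTop 0] with j hj hj0
  have h4 : (0 : ℝ) < m (j + r) := by have := hm (j + r); positivity
  have h5 : (0 : ℝ) < (j : ℝ) + r := by positivity
  rw [div_mul_div_comm, lt_div_iff₀ (by positivity)] at hj
  have h6 : ((j : ℝ) + r) * m (j + r) ≤ 2 * (j * m j) := by linarith
  exact_mod_cast h6

theorem prod_msWt_eq (m : ℕ → ℕ) (p : ℝ) {n : ℕ} (P : Nat.Partition n) {S : Finset ℕ}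
    (h : P.parts.toFinset ⊆ S) :
    ∏ j ∈ S, msWt m p j (P.parts.count j) = p ^ n * multisetWeight m P.parts := by
  have hn : ∑ j ∈ S, j * P.parts.count j = n := by
    conv_rhs => rw [← P.parts_sum, Finset.sum_multiset_count]
    simp_rw [smul_eq_mul]
    refine (Finset.sum_subset_zero_on_sdiff h (fun j hj => ?_) fun j _ => mul_comm _ _).symm
    rw [Multiset.count_eq_zero_of_notMem (by simpa using (Finset.mem_sdiff.1 hj).2), mul_zero]
  unfold msWt
  rw [Finset.prod_mul_distrib, Finset.prod_pow_eq_pow_sum, hn, multisetWeight_eq_prod m h,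
    mul_comm]
  simp_rw [Nat.multichoose_eq]
  push_cast
  rfl

theorem ctilOf_msWt (m : ℕ → ℕ) (p : ℝ) (n : ℕ) :
    ctilOf (msWt m p) n = p ^ n * multisetCount m n := by
  unfold ctilOf multisetCount
  push_cast
  rw [Finset.mul_sum]
  exact Finset.sum_congr rfl fun P _ => prod_msWt_eq m p P (parts_toFinset_subset P le_rfl)

theorem TtilOf_msWt (m : ℕ → ℕ) (p : ℝ) (l n : ℕ) :
    TtilOf (msWt m p) l n = p ^ n * multisetCount (fun j => if l < j then m j else 0) n := by
  unfold TtilOf multisetCount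
  push_cast
  rw [Finset.mul_sum]
  refine Finset.sum_congr rfl fun P _ => ?_
  split_ifs with h
  · rw [prod_msWt_eq m p P fun x hx => ?_]
    · congr 2
      refine Finset.prod_congr rfl fun j hj => ?_
      simp only [if_pos (h j (Multiset.mem_toFinset.1 hj))]
    · have h1 := Finset.mem_Icc.1 (parts_toFinset_subset P le_rfl hx)
      exact Finset.mem_Icc.2 ⟨h x (Multiset.mem_toFinset.1 hx), h1.2⟩
  · push Not at h
    obtain ⟨j, hj, hlj⟩ := h
    rw [multisetWeight_eq_zero (j := j) (by simp [hlj]) hj, Nat.cast_zero, mul_zero]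

theorem PformOf_msWt (m : ℕ → ℕ) {p : ℝ} (hp : p ≠ 0) (l : ℕ) (k : Fin l → ℕ) {n : ℕ}
    (hn : ∑ i : Fin l, ((i : ℕ) + 1) * k i ≤ n) :
    PformOf (msWt m p) l k n = (∏ i : Fin l, (m (i + 1)).multichoose (k i) : ℕ) *
      (multisetCount (fun j => if l < j then m j else 0)
        (n - ∑ i : Fin l, ((i : ℕ) + 1) * k i) / multisetCount m n : ℝ) := by
  have h : ∏ i : Fin l, msWt m p (i + 1) (k i) =
      (∏ i : Fin l, (m (i + 1)).multichoose (k i) : ℕ) *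
        p ^ (∑ i : Fin l, ((i : ℕ) + 1) * k i) := by
    unfold msWt
    rw [Finset.prod_mul_distrib, Finset.prod_pow_eq_pow_sum]
    push_cast
    simp_rw [Nat.multichoose_eq]
  unfold PformOf
  rw [ctilOf_msWt, TtilOf_msWt, h]
  have hpn : p ^ n = p ^ (∑ i : Fin l, ((i : ℕ) + 1) * k i) *
      p ^ (n - ∑ i : Fin l, ((i : ℕ) + 1) * k i) := by
    rw [← pow_add, Nat.add_sub_cancel' hn]
  rw [hpn]
  set M := ∑ i : Fin l, ((i : ℕ) + 1) * k i
  rw [show ∀ a b c d : ℝ, a * b * (c * d) = (b * c) * (a * d) by intros; ring,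
    mul_div_mul_left _ _ (by positivity), mul_div_assoc]

/-- **Multisets with smoothly growing weights diverge.** If
`ã_k^{(j)} = C(m_j+k−1,k) p^{jk}` with `m_j ≥ 1` integers satisfying `m_j/m_{j+1} → 1`
and `0 < p < 1`, then for every `l ≥ 1` and every tuple `(k_1,…,k_l) ∈ ℕ^l`,
`lim P_n(k_1,…,k_l) = 0`: the multiset is divergent. -/
theorem stmt16 (m : ℕ → ℕ) (hm : ∀ j, 1 ≤ m j)
    (hsm : Tendsto (fun j => (m j : ℝ) / (m (j + 1) : ℝ)) atTop (nhds 1))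
    (p : ℝ) (hp0 : 0 < p) (hp1 : p < 1) :
    ∀ l, 1 ≤ l → ∀ k : Fin l → ℕ,
      Tendsto (fun n => PformOf (msWt m p) l k n) atTop (nhds 0) := by
  intro l hl k
  set m' : ℕ → ℕ := fun j => if l < j then m j else 0 with hm'
  set M := ∑ i : Fin l, ((i : ℕ) + 1) * k i
  have hmul : ∀ r, ∀ᶠ j in atTop, (j + r) * m' (j + r) ≤ 2 * (j * m' j) := by
    intro r
    filter_upwards [eventually_add_mul_le hm hsm r, eventually_gt_atTop l] with j hj hlj
    simpa [hm', hlj, show l < j + r by omega] using hj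
  have hev := eventually_mul_multisetCount_le (m := m') (l := l)
    (fun j hj => by simpa [hm', hj] using hm j) hmul
  have hsum := sum_multisetCount_le (m' := m') hm
    (fun j => by by_cases h : l < j <;> simp [hm', h]) (by simp [hm']; omega)
  have hlim : Tendsto (fun n => (multisetCount m' (n - M) / multisetCount m n : ℝ)) atTop
      (nhds 0) := by
    rw [Metric.tendsto_nhds]
    intro ε hε
    obtain ⟨K, hK⟩ := exists_nat_gt (1 / ε)
    have hK0 : (0 : ℝ) < K := (by positivity : (0 : ℝ) < 1 / ε).trans hK
    filter_upwards [(tendsto_sub_atTop_nat M).eventually (hev K)] with n hn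
    have h1 : K * multisetCount m' (n - M) ≤ multisetCount m n := by
      refine hn.trans (le_trans (Finset.sum_le_sum_of_subset ?_) (hsum n))
      exact Finset.range_subset_range.2 (by omega)
    have h2 : (K : ℝ) * multisetCount m' (n - M) ≤ multisetCount m n := by exact_mod_cast h1
    rw [Real.dist_eq, sub_zero, abs_of_nonneg (by positivity)]
    refine lt_of_le_of_lt (div_le_of_le_mul₀ (by positivity) (by positivity) ?_)
      ((one_div_lt hε hK0).1 hK)
    rw [one_div, ← div_eq_inv_mul, le_div_iff₀ hK0]
    linarith
  have h := hlim.const_mul ((∏ i : Fin l, (m (i + 1)).multichoose (k i) : ℕ) : ℝ)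
  rw [mul_zero] at h
  refine h.congr' ?_
  filter_upwards [eventually_ge_atTop M] with n hn
  exact (PformOf_msWt m hp0.ne' l k hn).symm
end

section
/- (Uniform random integer partitions diverge) For n ≥ 1 let p(n) denote the number of partitions of n, and for l ≥ 1 and nonnegative integers k_1,…,k_l with ∑_{j=1}^l j·k_j ≤ n let N_n(k_1,…,k_l) be the number of partitions of n having exactly k_j parts of size j for each j = 1,…,l. Then for every fixed l ≥ 1 and every fixed tuple (k_1,…,k_l) ∈ ℕ^l, N_n(k_1,…,k_l)/p(n) → 0 as n → ∞; i.e., under the uniform measure on partitions of n, the probability that the counts of parts of sizes 1,…,l equal any fixed values tends to 0. -/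
open Finset Filter Topology

/-- The number `N_n(k_1,…,k_l)` of partitions of `n` having exactly `k_j` parts of size
`j` for each `j = 1,…,l`. -/
noncomputable def Ncount (n l : ℕ) (k : Fin l → ℕ) : ℕ :=
  (Finset.univ.filter (fun P : Nat.Partition n =>
    ∀ i : Fin l, Multiset.count ((i : ℕ) + 1) P.parts = k i)).card

/-- Few distinct part sizes: polynomially many partitions. -/
theorem card_partition_card_toFinset_le (n M : ℕ) :
    #{P : Nat.Partition n | #P.parts.toFinset ≤ M} ≤ (n + 1) ^ (2 * M) := by
  have hcard : #(Finset.univ : Finset (Fin M → Fin (n + 1) × Fin (n + 1))) =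
      (n + 1) ^ (2 * M) := by
    simp [pow_mul, sq]
  rw [← hcard]
  let size (P : Nat.Partition n) (i : ℕ) : ℕ := P.parts.toFinset.toList.getD i 0
  have hsize (P : Nat.Partition n) (i : ℕ) : size P i < n + 1 := by
    by_cases hi : i < P.parts.toFinset.toList.length
    · have hm : P.parts.toFinset.toList[i] ∈ P.parts.toFinset :=
        Finset.mem_toList.1 (List.getElem_mem hi)
      have := P.le_of_mem_parts (Multiset.mem_toFinset.1 hm)
      simp only [size, List.getD_eq_getElem _ _ hi]
      omega
    · simp only [size, List.getD_eq_default _ _ (not_lt.1 hi)]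
      omega
  have hcount (P : Nat.Partition n) (a : ℕ) : P.parts.count a < n + 1 := by
    rcases Nat.eq_zero_or_pos a with rfl | ha
    · rw [Multiset.count_eq_zero.2 fun h => (P.parts_pos h).ne' rfl]
      omega
    · have hle : Multiset.replicate (P.parts.count a) a ≤ P.parts :=
        Multiset.le_count_iff_replicate_le.1 le_rfl
      obtain ⟨t, ht⟩ := Multiset.le_iff_exists_add.1 hle
      have hs := congrArg Multiset.sum ht
      rw [P.parts_sum, Multiset.sum_add, Multiset.sum_replicate, smul_eq_mul] at hs
      have := Nat.le_mul_of_pos_right (P.parts.count a) ha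
      omega
  refine Finset.card_le_card_of_injOn
    (fun P i => (⟨size P i, hsize P i⟩, ⟨P.parts.count (size P i), hcount P _⟩))
    (fun _ _ => Finset.mem_coe.2 (Finset.mem_univ _)) ?_
  intro P hP Q hQ hPQ
  have hmem (R : Nat.Partition n) (hR : #R.parts.toFinset ≤ M) (a : ℕ) (ha : a ∈ R.parts) :
      ∃ i : Fin M, size R i = a := by
    obtain ⟨i, hi, rfl⟩ := List.getElem_of_mem
      (Finset.mem_toList.2 (Multiset.mem_toFinset.2 ha))
    have hi' := hi
    rw [Finset.length_toList] at hi'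
    exact ⟨⟨i, hi'.trans_le hR⟩, List.getD_eq_getElem _ _ hi⟩
  have heq (i : Fin M) : size P i = size Q i ∧
      P.parts.count (size P i) = Q.parts.count (size Q i) := by
    have := congrFun hPQ i
    simpa only [Prod.mk.injEq, Fin.mk.injEq] using this
  simp only [Finset.coe_filter, Finset.mem_univ, true_and, Set.mem_ofPred_eq] at hP hQ
  refine Nat.Partition.ext (Multiset.ext.2 fun a => ?_)
  by_cases haP : a ∈ P.parts
  · obtain ⟨i, rfl⟩ := hmem P hP a haP
    rw [(heq i).2, (heq i).1]
  by_cases haQ : a ∈ Q.parts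
  · obtain ⟨i, rfl⟩ := hmem Q hQ a haQ
    rw [← (heq i).2, (heq i).1]
  rw [Multiset.count_eq_zero.2 haP, Multiset.count_eq_zero.2 haQ]

/-- Sets of distinct parts in `{2, …, √n}`, completed by ones, are partitions of `n`. -/
theorem two_pow_sqrt_le_card_partition (n : ℕ) :
    2 ^ (n.sqrt - 1) ≤ Fintype.card (Nat.Partition n) := by
  have hsum (S : Finset ℕ) (hS : S ∈ (Finset.Ico 2 (n.sqrt + 1)).powerset) :
      S.val.sum ≤ n := by
    rw [Finset.mem_powerset] at hS
    calc S.val.sum = ∑ i ∈ S, i := (Finset.sum_val S).trans rfl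
      _ ≤ #S • n.sqrt := Finset.sum_le_card_nsmul _ _ _ fun i hi => by
        have := Finset.mem_Ico.1 (hS hi); omega
      _ ≤ n.sqrt * n.sqrt := by
        have := Finset.card_le_card hS
        rw [Nat.card_Ico] at this
        exact Nat.mul_le_mul_right _ (by omega)
      _ ≤ n := Nat.sqrt_le n
  have hcard : #(Finset.Ico 2 (n.sqrt + 1)).powerset = 2 ^ (n.sqrt - 1) := by
    rw [Finset.card_powerset, Nat.card_Ico]
    rfl
  rw [← hcard]
  refine le_trans (Finset.card_le_card_of_injOn
    (t := Finset.univ.image (Nat.Partition.parts (n := n)))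
    (fun S => S.val + Multiset.replicate (n - S.val.sum) 1) ?_ ?_) Finset.card_image_le
  · intro S hS
    refine Finset.mem_coe.2 (Finset.mem_image.2 ⟨⟨_, ?_, ?_⟩, Finset.mem_univ _, rfl⟩)
    · intro i hi
      rcases Multiset.mem_add.1 hi with hi | hi
      · have := Finset.mem_Ico.1 (Finset.mem_powerset.1 (Finset.mem_coe.1 hS) hi)
        omega
      · rw [Multiset.eq_of_mem_replicate hi]
        exact one_pos
    · have := hsum S (Finset.mem_coe.1 hS)
      rw [Multiset.sum_add, Multiset.sum_replicate, smul_eq_mul]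
      omega
  · intro S hS T hT hST
    have key (U : Finset ℕ) (hU : U ∈ (Finset.Ico 2 (n.sqrt + 1)).powerset) (a : ℕ) :
        a ∈ U ↔ a ≠ 1 ∧ a ∈ U.val + Multiset.replicate (n - U.val.sum) 1 := by
      rw [Multiset.mem_add, Finset.mem_val]
      constructor
      · intro ha
        have := Finset.mem_Ico.1 (Finset.mem_powerset.1 hU ha)
        exact ⟨by omega, Or.inl ha⟩
      · rintro ⟨h1, ha | ha⟩
        · exact ha
        · exact absurd (Multiset.eq_of_mem_replicate ha) h1
    ext a
    rw [key S (Finset.mem_coe.1 hS), key T (Finset.mem_coe.1 hT)]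
    exact and_congr_right fun _ => by rw [show S.val + _ = T.val + _ from hST]

/-- Breaking one part of size `j ≠ 1` into ones is injective in the partition and in `j`, once
the initial number of ones is fixed. -/
theorem sum_card_erase_one_le_card_partition (n c : ℕ) :
    ∑ P : Nat.Partition n with P.parts.count 1 = c, #(P.parts.toFinset.erase 1) ≤
      Fintype.card (Nat.Partition n) := by
  rw [← Finset.card_sigma]
  refine le_trans (Finset.card_le_card_of_injOn
    (t := Finset.univ.image (Nat.Partition.parts (n := n)))
    (fun x => x.1.parts.erase x.2 + Multiset.replicate x.2 1) ?_ ?_) Finset.card_image_le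
  · rintro ⟨P, j⟩ hx
    simp only [Finset.coe_sigma, Set.mem_sigma_iff, Finset.mem_coe, Finset.mem_erase,
      Multiset.mem_toFinset] at hx
    refine Finset.mem_coe.2 (Finset.mem_image.2 ⟨⟨_, ?_, ?_⟩, Finset.mem_univ _, rfl⟩)
    · intro i hi
      rcases Multiset.mem_add.1 hi with hi | hi
      · exact P.parts_pos (Multiset.mem_of_mem_erase hi)
      · rw [Multiset.eq_of_mem_replicate hi]
        exact one_pos
    · have h := Multiset.sum_erase hx.2.2
      rw [P.parts_sum] at h
      rw [Multiset.sum_add, Multiset.sum_replicate, smul_eq_mul]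
      dsimp only
      omega
  · rintro ⟨P, i⟩ hP ⟨Q, j⟩ hQ h
    simp only [Finset.coe_sigma, Set.mem_sigma_iff, Finset.mem_coe, Finset.mem_erase,
      Multiset.mem_toFinset, Finset.mem_filter, Finset.mem_univ, true_and] at hP hQ
    dsimp only at h
    have hij : i = j := by
      have h1 := congrArg (Multiset.count 1) h
      rw [Multiset.count_add, Multiset.count_add, Multiset.count_replicate_self,
        Multiset.count_replicate_self, Multiset.count_erase_of_ne (Ne.symm hP.2.1),
        Multiset.count_erase_of_ne (Ne.symm hQ.2.1)] at h1
      omega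
    subst hij
    have hPQ : P = Q := by
      refine Nat.Partition.ext ?_
      rw [← Multiset.cons_erase hP.2.2, ← Multiset.cons_erase hQ.2.2, add_right_cancel h]
    rw [hPQ]

theorem mul_card_count_one_le (n c M : ℕ) :
    M * #{P : Nat.Partition n | P.parts.count 1 = c} ≤
      Fintype.card (Nat.Partition n) + M * (n + 1) ^ (2 * M) := by
  calc M * #{P : Nat.Partition n | P.parts.count 1 = c}
      = ∑ P : Nat.Partition n with P.parts.count 1 = c, M := by
        rw [Finset.sum_const, smul_eq_mul, mul_comm]
    _ ≤ ∑ P : Nat.Partition n with P.parts.count 1 = c,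
          (#(P.parts.toFinset.erase 1) + if #P.parts.toFinset ≤ M then M else 0) := by
        refine Finset.sum_le_sum fun P _ => ?_
        have := Finset.pred_card_le_card_erase (s := P.parts.toFinset) (a := 1)
        split_ifs <;> omega
    _ ≤ Fintype.card (Nat.Partition n) +
          ∑ P : Nat.Partition n, if #P.parts.toFinset ≤ M then M else 0 := by
        rw [Finset.sum_add_distrib]
        exact add_le_add (sum_card_erase_one_le_card_partition n c)
          (Finset.sum_le_sum_of_subset (Finset.filter_subset _ _))
    _ ≤ _ := by
        rw [← Finset.sum_filter, Finset.sum_const, smul_eq_mul, mul_comm]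
        gcongr
        exact card_partition_card_toFinset_le n M

theorem tendsto_pow_div_card_partition (K : ℕ) :
    Tendsto (fun n : ℕ => ((n : ℝ) + 1) ^ K / (Fintype.card (Nat.Partition n) : ℝ))
      atTop (𝓝 0) := by
  have hsqrt : Tendsto (fun n : ℕ => n.sqrt + 1) atTop atTop := by
    refine tendsto_atTop.2 fun b => ?_
    filter_upwards [eventually_ge_atTop (b * b)] with n hn
    have := Nat.le_sqrt.2 hn
    omega
  have hlim := ((tendsto_pow_const_div_const_pow_of_one_lt (2 * K)
    (one_lt_two : (1 : ℝ) < 2)).comp hsqrt).const_mul 4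
  rw [mul_zero] at hlim
  refine squeeze_zero' (Eventually.of_forall fun n => by positivity) ?_ hlim
  filter_upwards [eventually_ge_atTop 1] with n hn
  have hs : 1 ≤ n.sqrt := Nat.le_sqrt.2 (by simpa using hn)
  have hp : (2 : ℝ) ^ (n.sqrt - 1) ≤ Fintype.card (Nat.Partition n) := by
    exact_mod_cast two_pow_sqrt_le_card_partition n
  have hn' : (n : ℝ) + 1 ≤ ((n.sqrt + 1 : ℕ) : ℝ) ^ 2 := by
    have := Nat.succ_le_succ_sqrt' n
    exact_mod_cast this
  have h4 : (2 : ℝ) ^ (n.sqrt + 1) = 4 * 2 ^ (n.sqrt - 1) := by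
    rw [show n.sqrt + 1 = 2 + (n.sqrt - 1) by omega, pow_add]
    norm_num
  calc ((n : ℝ) + 1) ^ K / (Fintype.card (Nat.Partition n) : ℝ)
      ≤ (((n.sqrt + 1 : ℕ) : ℝ) ^ 2) ^ K / 2 ^ (n.sqrt - 1) := by gcongr
    _ = 4 * (((n.sqrt + 1 : ℕ) : ℝ) ^ (2 * K) / 2 ^ (n.sqrt + 1)) := by
        rw [h4, pow_mul]
        field_simp

theorem tendsto_card_count_one_div_card_partition (c : ℕ) :
    Tendsto (fun n : ℕ => (#{P : Nat.Partition n | P.parts.count 1 = c} : ℝ) /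
      (Fintype.card (Nat.Partition n) : ℝ)) atTop (𝓝 0) := by
  refine tendsto_order.2 ⟨fun a ha => Eventually.of_forall fun n =>
    ha.trans_le (by positivity), fun ε hε => ?_⟩
  obtain ⟨m, hm⟩ := exists_nat_one_div_lt (half_pos hε)
  filter_upwards [(tendsto_pow_div_card_partition (2 * (m + 1))).eventually_lt_const
    (half_pos hε)] with n hn
  have hp : (0 : ℝ) < Fintype.card (Nat.Partition n) := by
    exact_mod_cast Fintype.card_pos
  have hM : (0 : ℝ) < (m : ℝ) + 1 := by positivity
  have key : ((m : ℝ) + 1) * #{P : Nat.Partition n | P.parts.count 1 = c} ≤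
      Fintype.card (Nat.Partition n) + ((m : ℝ) + 1) * ((n : ℝ) + 1) ^ (2 * (m + 1)) := by
    exact_mod_cast mul_card_count_one_le n c (m + 1)
  calc (#{P : Nat.Partition n | P.parts.count 1 = c} : ℝ) / Fintype.card (Nat.Partition n)
      ≤ 1 / ((m : ℝ) + 1) +
          ((n : ℝ) + 1) ^ (2 * (m + 1)) / Fintype.card (Nat.Partition n) := by
        rw [div_add_div _ _ hM.ne' hp.ne', div_le_div_iff₀ hp (mul_pos hM hp)]
        nlinarith [mul_le_mul_of_nonneg_right key hp.le]
    _ < ε := by linarith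

/-- **Uniform random integer partitions diverge.** For every fixed `l ≥ 1` and every
fixed tuple `(k_1,…,k_l) ∈ ℕ^l`, `N_n(k_1,…,k_l)/p(n) → 0` as `n → ∞`, where `p(n)` is
the number of partitions of `n`: under the uniform measure on partitions of `n`, the
probability that the counts of parts of sizes `1,…,l` equal any fixed values tends
to `0`. -/
theorem stmt17 :
    ∀ l : ℕ, 1 ≤ l → ∀ k : Fin l → ℕ,
      Tendsto
        (fun n => (Ncount n l k : ℝ) / (Fintype.card (Nat.Partition n) : ℝ))
        atTop (nhds 0) := by
  intro l hl k
  refine squeeze_zero (fun n => by positivity) (fun n => ?_)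
    (tendsto_card_count_one_div_card_partition (k ⟨0, hl⟩))
  gcongr
  refine Finset.card_le_card fun P hP => ?_
  simp only [Finset.mem_filter, Finset.mem_univ, true_and] at hP ⊢
  exact hP ⟨0, hl⟩
end
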